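/- (Nichtnegativstellensatz on singular varieties under denseness of the regular locus.) Let V ⊆ ℝⁿ be a set and f ∈ ℝ[x₁,…,x_n]. Let h = (h₁,…,h_l) with h_j ∈ ℝ[y₁,…,y_t], let W = V(h) ⊆ ℝᵗ, and let φ : ℝᵗ → ℝⁿ be a polynomial map with φ(W) ⊆ V. Assume there is a set S ⊆ V that is dense in V (usual topology) with S ⊆ φ(W). Set h₀ := f∘φ ∈ ℝ[y], h̄ := (h₀, h), and let d ≥ 2 be an upper bound for the degrees of h₀, h₁, …, h_l. Assume h₀ attains its infimum on W at some global minimizer y*, and that there exists λ* ∈ ℝˡ with (y*, λ*) ∈ V(h̄_KKT) (as holds when W is a regular variety and h generates the vanishing ideal of W). Set u := max{d·(c(t+l, d, t+l) − 1), (1/2)·b(t+l, d, l+t+1) + d}. Then the following are equivalent: (a) f is non-negative on V; (b) there exists σ ∈ Σ²_u[y, λ] such that h₀ − σ vanishes identically on V(h̄_KKT). -/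

import Mathlib

open MvPolynomial

/-- `bit(d)`: the number of binary digits of `d`, with `bit(0) = 1`. -/
def bitNum (d : ℕ) : ℕ := if d = 0 then 1 else Nat.log2 d + 1

/-- The bound `b(n,d,s) = 2^(2^(2^(max{2,d}^(4^n)) + s^(2^n)·max{2,d}^(16^n·bit(d))))`. -/
def bFun (n d s : ℕ) : ℕ :=
  2 ^ 2 ^ (2 ^ (max 2 d) ^ 4 ^ n + s ^ 2 ^ n * (max 2 d) ^ (16 ^ n * bitNum d))

/-- The bound `c(n,d,s) = d(2d-1)^(n+s-1)`. -/
def cFun (n d s : ℕ) : ℕ := d * (2 * d - 1) ^ (n + s - 1)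

/-- `σ ∈ Σ²_w`: a finite sum of squares of polynomials of degree at most `w`. -/
def IsSOS {σv : Type*} (w : ℕ) (p : MvPolynomial σv ℝ) : Prop :=
  ∃ (k : ℕ) (q : Fin k → MvPolynomial σv ℝ),
    (∀ i, (q i).totalDegree ≤ w) ∧ p = ∑ i, q i ^ 2

/-- The KKT variety `V(h̄_KKT) ⊆ ℝᵗ × ℝˡ` associated with `h̄ = (h₀, h₁,…,h_l)`. -/
def KKTset {t l : ℕ} (h₀ : MvPolynomial (Fin t) ℝ)
    (h : Fin l → MvPolynomial (Fin t) ℝ) : Set ((Fin t → ℝ) × (Fin l → ℝ)) :=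
  {p | (∀ j, eval p.1 (h j) = 0) ∧
       ∀ i, eval p.1 (pderiv i h₀) = ∑ j, p.2 j * eval p.1 (pderiv i (h j))}


open scoped KaehlerDifferential in
lemma aux_isAlgebraic {L : Type} [Field L] [Algebra ℝ L] [Algebra.EssFiniteType ℝ L] (x : L)
    (hx : KaehlerDifferential.D ℝ L x = 0) : IsAlgebraic ℝ x := by
  by_contra htr
  have hinj : Function.Injective (Polynomial.aeval x : Polynomial ℝ →ₐ[ℝ] L) :=
    transcendental_iff_injective.mp htr
  let alg1 : Algebra (Polynomial ℝ) L := (Polynomial.aeval x : Polynomial ℝ →ₐ[ℝ] L).toRingHom.toAlgebra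
  have hmap : ∀ p : Polynomial ℝ, algebraMap (Polynomial ℝ) L p = Polynomial.aeval x p := fun _ => rfl
  have : IsScalarTower ℝ (Polynomial ℝ) L := IsScalarTower.of_algebraMap_eq (fun r => by
    rw [hmap]; simp)
  have : FaithfulSMul (Polynomial ℝ) L := (faithfulSMul_iff_algebraMap_injective _ _).2 hinj
  let alg2 : Algebra (FractionRing (Polynomial ℝ)) L := FractionRing.liftAlgebra _ _
  have : IsScalarTower (Polynomial ℝ) (FractionRing (Polynomial ℝ)) L :=
    FractionRing.isScalarTower_liftAlgebra _ _
  have : IsScalarTower ℝ (FractionRing (Polynomial ℝ)) L :=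
    IsScalarTower.of_algebraMap_eq (fun r => by
      rw [IsScalarTower.algebraMap_apply ℝ (Polynomial ℝ) (FractionRing (Polynomial ℝ)),
        ← IsScalarTower.algebraMap_apply (Polynomial ℝ) (FractionRing (Polynomial ℝ)) L,
        ← IsScalarTower.algebraMap_apply])
  have : Algebra.EssFiniteType (FractionRing (Polynomial ℝ)) L :=
    Algebra.EssFiniteType.of_comp ℝ _ _
  have : CharZero (FractionRing (Polynomial ℝ)) := 
    charZero_of_injective_algebraMap (algebraMap ℝ (FractionRing (Polynomial ℝ))).injective
  have : Algebra.FormallySmooth (FractionRing (Polynomial ℝ)) L := inferInstance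
  have : Algebra.FormallySmooth (Polynomial ℝ) (FractionRing (Polynomial ℝ)) :=
    .of_isLocalization (nonZeroDivisors _)
  have : Algebra.FormallySmooth (Polynomial ℝ) L := .comp _ (FractionRing (Polynomial ℝ)) _
  have key : Function.Injective (KaehlerDifferential.mapBaseChange ℝ (Polynomial ℝ) L) := by
    rw [injective_iff_map_eq_zero]
    intro z hz
    obtain ⟨w, rfl⟩ := (Algebra.H1Cotangent.exact_δ_mapBaseChange ℝ (Polynomial ℝ) L z).mp hz
    rw [Subsingleton.elim w 0, map_zero]
  have h0 : (1 : L) ⊗ₜ[Polynomial ℝ] (KaehlerDifferential.D ℝ (Polynomial ℝ) Polynomial.X) = 0 := by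
    apply key
    rw [KaehlerDifferential.mapBaseChange_tmul, KaehlerDifferential.map_D, hmap]
    simp [hx]
  have h1 := congrArg ((KaehlerDifferential.polynomialEquiv ℝ).toLinearMap.lTensor L) h0
  rw [LinearMap.lTensor_tmul, map_zero] at h1
  simp only [LinearEquiv.coe_coe, KaehlerDifferential.polynomialEquiv_D, Polynomial.derivative_X] at h1
  have h2 := congrArg (TensorProduct.rid (Polynomial ℝ) L) h1
  simp at h2

lemma aux_derivation {σ : Type*} [Fintype σ] {M : Type*} [AddCommGroup M] [Module ℝ M]
    [Module (MvPolynomial σ ℝ) M] [IsScalarTower ℝ (MvPolynomial σ ℝ) M]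
    (D : Derivation ℝ (MvPolynomial σ ℝ) M) (p : MvPolynomial σ ℝ) :
    D p = ∑ i, pderiv i p • D (X i) := by
  classical
  induction p using MvPolynomial.induction_on with
  | C a => simp
  | add p q hp hq => simp [hp, hq, add_smul, Finset.sum_add_distrib]
  | mul_X p i hp =>
    rw [Derivation.leibniz, hp]
    simp only [Derivation.leibniz, add_smul, Finset.sum_add_distrib, smul_eq_mul, mul_smul, Finset.smul_sum]
    congr 1
    rw [Finset.sum_eq_single i]
    · simp
    · intro b _ hb
      simp [pderiv_X_of_ne hb.symm]
    · simp

open scoped KaehlerDifferential in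
lemma aux_D {σ ι : Type} [Fintype σ] [Fintype ι] {L : Type} [Field L] [Algebra ℝ L]
    [Algebra (MvPolynomial σ ℝ) L] [IsScalarTower ℝ (MvPolynomial σ ℝ) L]
    (g : MvPolynomial σ ℝ) (r μ : ι → MvPolynomial σ ℝ)
    (hr : ∀ j, algebraMap (MvPolynomial σ ℝ) L (r j) = 0)
    (hg : ∀ i, algebraMap (MvPolynomial σ ℝ) L (pderiv i g - ∑ j, μ j * pderiv i (r j)) = 0) :
    KaehlerDifferential.D ℝ L (algebraMap (MvPolynomial σ ℝ) L g) = 0 := by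
  let D := (KaehlerDifferential.D ℝ L).compAlgebraMap (MvPolynomial σ ℝ)
  have hD : ∀ p, D p = KaehlerDifferential.D ℝ L (algebraMap _ L p) := fun _ => rfl
  have hsm : ∀ p, algebraMap (MvPolynomial σ ℝ) L p = 0 → ∀ m : Ω[L⁄ℝ], p • m = 0 := by
    intro p hp m
    rw [← algebraMap_smul L p m, hp, zero_smul]
  have e : ∀ i, pderiv i g • D (X i) = ∑ j, μ j • (pderiv i (r j) • D (X i)) := by
    intro i
    have := hsm _ (hg i) (D (X i))
    rw [sub_smul, sub_eq_zero, Finset.sum_smul] at this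
    simpa [mul_smul] using this
  rw [← hD, aux_derivation D g, Finset.sum_congr rfl (fun i _ => e i), Finset.sum_comm]
  refine Finset.sum_eq_zero fun j _ => ?_
  rw [← Finset.smul_sum, ← aux_derivation D (r j), hD, hr j]
  simp

lemma aux_finite {σ ι : Type} [Fintype σ] [Fintype ι] (I : Ideal (MvPolynomial σ ℝ))
    (g : MvPolynomial σ ℝ) (r μ : ι → MvPolynomial σ ℝ) (hr : ∀ j, r j ∈ I)
    (hg : ∀ i, pderiv i g - ∑ j, μ j * pderiv i (r j) ∈ I) :
    {v : ℝ | ∃ x : σ → ℝ, (∀ p ∈ I, eval x p = 0) ∧ eval x g = v}.Finite := by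
  classical
  have hP : ∀ P ∈ I.minimalPrimes, ∃ q : Polynomial ℝ, q ≠ 0 ∧ Polynomial.aeval g q ∈ P := by
    intro P hP
    have : P.IsPrime := hP.1.1
    have hIP : I ≤ P := hP.1.2
    let A := MvPolynomial σ ℝ ⧸ P
    let L := FractionRing A
    have : Algebra.EssFiniteType ℝ L := Algebra.EssFiniteType.comp ℝ A L
    have hker : ∀ p ∈ P, algebraMap (MvPolynomial σ ℝ) L p = 0 := by
      intro p hp
      rw [IsScalarTower.algebraMap_apply (MvPolynomial σ ℝ) A L]
      have : algebraMap (MvPolynomial σ ℝ) A p = 0 := Ideal.Quotient.eq_zero_iff_mem.2 hp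
      rw [this, map_zero]
    have hker' : ∀ p, algebraMap (MvPolynomial σ ℝ) L p = 0 → p ∈ P := by
      intro p hp
      rw [IsScalarTower.algebraMap_apply (MvPolynomial σ ℝ) A L] at hp
      have := (map_eq_zero_iff _ (IsFractionRing.injective A L)).1 hp
      exact Ideal.Quotient.eq_zero_iff_mem.1 this
    have h0 := aux_D (L := L) g r μ (fun j => hker _ (hIP (hr j))) (fun i => hker _ (hIP (hg i)))
    obtain ⟨q, hq0, hq⟩ := aux_isAlgebraic _ h0
    refine ⟨q, hq0, hker' _ ?_⟩
    rw [← Polynomial.aeval_algebraMap_apply]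
    exact hq
  choose! q hq0 hq using hP
  refine ((Ideal.finite_minimalPrimes_of_isNoetherianRing _ I).biUnion
    (t := fun P => ((q P).roots.toFinset : Set ℝ)) (fun P _ => Finset.finite_toSet _)).subset ?_
  rintro v ⟨x, hx, rfl⟩
  have : (RingHom.ker (eval x : MvPolynomial σ ℝ →+* ℝ)).IsPrime := RingHom.ker_isPrime _
  obtain ⟨P, hPm, hPle⟩ := Ideal.exists_minimalPrimes_le (I := I)
    (J := RingHom.ker (eval x : MvPolynomial σ ℝ →+* ℝ)) (fun p hp => hx p hp)
  simp only [Set.mem_iUnion]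
  refine ⟨P, hPm, ?_⟩
  have := hPle (hq P hPm)
  rw [RingHom.mem_ker] at this
  simp only [Finset.mem_coe, Multiset.mem_toFinset, Polynomial.mem_roots (hq0 P hPm), Polynomial.IsRoot]
  rw [← this]
  have h3 := Polynomial.aeval_algHom_apply (aeval x : MvPolynomial σ ℝ →ₐ[ℝ] ℝ) g (q P)
  simpa [MvPolynomial.coe_aeval_eq_eval, MvPolynomial.aeval_eq_eval] using h3

lemma aux_totalDegree_aeval {σ τ : Type*} (D : ℕ) (Ψ : σ → MvPolynomial τ ℝ)
    (hΨ : ∀ i, (Ψ i).totalDegree ≤ D) (p : MvPolynomial σ ℝ) :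
    (aeval Ψ p).totalDegree ≤ D * p.totalDegree := by
  rw [aeval_def, eval₂_eq]
  refine totalDegree_finsetSum_le fun s hs => ?_
  refine (totalDegree_mul _ _).trans ?_
  rw [MvPolynomial.algebraMap_eq, totalDegree_C, zero_add]
  refine (totalDegree_finsetProd _ _).trans ?_
  calc ∑ i ∈ s.support, (Ψ i ^ s i).totalDegree ≤ ∑ i ∈ s.support, D * s i :=
        Finset.sum_le_sum fun i _ => (totalDegree_pow _ _).trans (by
          rw [mul_comm]; exact Nat.mul_le_mul_right _ (hΨ i))
    _ = D * (s.sum fun _ e => e) := by rw [← Finset.mul_sum]; rfl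
    _ ≤ _ := Nat.mul_le_mul_left _ (le_totalDegree hs)

lemma aux_totalDegree_poly {τ : Type*} (D : ℕ) (g : MvPolynomial τ ℝ)
    (hg : g.totalDegree ≤ D) (q : Polynomial ℝ) :
    (Polynomial.aeval g q).totalDegree ≤ D * q.natDegree := by
  rw [Polynomial.aeval_eq_sum_range]
  refine totalDegree_finsetSum_le fun i hi => ?_
  refine (totalDegree_smul_le _ _).trans ((totalDegree_pow _ _).trans ?_)
  rw [Finset.mem_range] at hi
  rw [mul_comm]
  exact Nat.mul_le_mul hg (by omega)

/-- exponent vectors of degree at most k -/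
abbrev expSet (σ : Type) (k : ℕ) : Set (σ →₀ ℕ) := {n | (n.sum fun _ e => e) ≤ k}

lemma expSet_mem {σ : Type} [Fintype σ] {k : ℕ} {s : σ →₀ ℕ} : s ∈ expSet σ k ↔ ∑ i, s i ≤ k := by
  simp [expSet, Finsupp.sum_fintype]

lemma expSet_inj {σ : Type} [Fintype σ] (k : ℕ) : Function.Injective
    (fun s : expSet σ k => (fun i => ⟨s.1 i, Nat.lt_succ_of_le
      ((Finset.single_le_sum (f := fun i => s.1 i) (fun _ _ => Nat.zero_le _) (Finset.mem_univ i)).trans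
        (expSet_mem.1 s.2))⟩ : σ → Fin (k + 1))) := by
  intro s t hst
  apply Subtype.ext
  ext i
  have := congrFun hst i
  simpa using this

lemma expSet_finite {σ : Type} [Fintype σ] (k : ℕ) : Finite (expSet σ k) :=
  Finite.of_injective _ (expSet_inj k)

lemma expSet_card_le {σ : Type} [Fintype σ] (k : ℕ) :
    Nat.card (expSet σ k) ≤ (k + 1) ^ Fintype.card σ := by
  classical
  refine (Nat.card_le_card_of_injective _ (expSet_inj k)).trans ?_
  simp

lemma expSet_card_mul {σ : Type} [Fintype σ] (D k : ℕ) (hD : 0 < D) :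
    Nat.card (expSet σ (D * k)) ≤ D ^ Fintype.card σ * Nat.card (expSet σ k) := by
  classical
  have := expSet_finite (σ := σ) k
  let F : expSet σ (D * k) → (σ → Fin D) × expSet σ k := fun s =>
    (fun i => ⟨s.1 i % D, Nat.mod_lt _ hD⟩, ⟨Finsupp.equivFunOnFinite.symm (fun i => s.1 i / D), by
      rw [expSet_mem]
      have h := expSet_mem.1 s.2
      have h2 : D * ∑ i, s.1 i / D ≤ D * k := by
        refine le_trans ?_ h
        rw [Finset.mul_sum]
        exact Finset.sum_le_sum fun i _ => Nat.mul_div_le _ _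
      simpa using Nat.le_of_mul_le_mul_left h2 hD⟩)
  have hF : Function.Injective F := by
    intro s t hst
    apply Subtype.ext
    ext i
    have h1 := congrFun (congrArg Prod.fst hst) i
    have h2 := DFunLike.congr_fun (congrArg Subtype.val (congrArg Prod.snd hst)) i
    simp only [F, Fin.mk.injEq] at h1
    simp only [F, Finsupp.equivFunOnFinite_symm_apply_apply] at h2
    rw [← Nat.div_add_mod (s.1 i) D, ← Nat.div_add_mod (t.1 i) D, h1, h2]
  refine (Nat.card_le_card_of_injective F hF).trans ?_
  simp [Nat.card_prod]

lemma finrank_restrict {σ : Type} [Fintype σ] (k : ℕ) :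
    Module.finrank ℝ (restrictTotalDegree σ ℝ k) = Nat.card (expSet σ k) :=
  Module.finrank_eq_nat_card_basis (basisRestrictSupport ℝ (expSet σ k))

lemma growth_contra (n q e : ℕ) (hq : 0 < q) (m : ℕ → ℕ) (hm : ∀ k, m k ≤ (k + 1) ^ n) (h0 : 0 < m 0)
    (h : ∀ k, (q + 1) * m k ≤ q * m (k + e)) : False := by
  have h1 : ∀ j, (q + 1) ^ j ≤ q ^ j * m (j * e) := by
    intro j
    induction j with
    | zero => simp; omega
    | succ j ih =>
      calc (q + 1) ^ (j + 1) = (q + 1) ^ j * (q + 1) := pow_succ _ _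
        _ ≤ (q ^ j * m (j * e)) * (q + 1) := Nat.mul_le_mul_right _ ih
        _ = q ^ j * ((q + 1) * m (j * e)) := by ring
        _ ≤ q ^ j * (q * m (j * e + e)) := Nat.mul_le_mul_left _ (h _)
        _ = q ^ (j + 1) * m ((j + 1) * e) := by rw [add_mul, one_mul]; ring
  have hqr : (0 : ℝ) < q := by exact_mod_cast hq
  have hr : (1 : ℝ) < (q + 1) / q := by rw [lt_div_iff₀ hqr]; linarith
  have ht := (tendsto_pow_const_div_const_pow_of_one_lt n hr).const_mul (((e : ℝ) + 1) ^ n)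
  rw [mul_zero] at ht
  have hev := (ht.eventually (gt_mem_nhds one_pos)).and (Filter.eventually_ge_atTop 1)
  obtain ⟨j, hj, hj1⟩ := hev.exists
  have hpos : (0 : ℝ) < ((q + 1) / q) ^ j := by positivity
  rw [← mul_div_assoc, div_lt_one hpos, ← mul_pow] at hj
  have h2 : ((q : ℝ) + 1) ^ j ≤ q ^ j * (((e : ℝ) + 1) * j) ^ n := by
    have h3 := (h1 j).trans (Nat.mul_le_mul_left _ (hm (j * e)))
    have h4 : (j * e + 1) ^ n ≤ ((e + 1) * j) ^ n := Nat.pow_le_pow_left (by nlinarith) _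
    have h5 := h3.trans (Nat.mul_le_mul_left _ h4)
    exact_mod_cast h5
  rw [div_pow, lt_div_iff₀ (by positivity)] at hj
  linarith

lemma bezout_bound {σ : Type} [Fintype σ] (D M : ℕ) (hD : 0 < D) (Ψ : σ → MvPolynomial σ ℝ)
    (hΨ : ∀ i, (Ψ i).totalDegree ≤ D) (g : MvPolynomial σ ℝ) (δ : ℝ) (hδ : 0 < δ)
    (H : ∀ a : σ → ℝ, (∀ i, |a i| < δ) → ∃ x : Fin M → (σ → ℝ),
      (∀ j i, eval (x j) (Ψ i) = a i) ∧ Function.Injective (fun j => eval (x j) g)) :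
    M ≤ D ^ Fintype.card σ := by
  classical
  by_contra hlt
  push Not at hlt
  set q := D ^ Fintype.card σ with hqdef
  have hq : 0 < q := by positivity
  set e := M * g.totalDegree with he
  refine growth_contra (Fintype.card σ) q e hq (fun k => Nat.card (expSet σ k)) expSet_card_le ?_ ?_
  · have := expSet_finite (σ := σ) 0
    have : Nonempty (expSet σ 0) := ⟨⟨0, by simp [expSet]⟩⟩
    exact Nat.card_pos
  intro k
  refine le_trans (Nat.mul_le_mul_right _ (Nat.succ_le_of_lt hlt)) ?_
  refine le_trans ?_ (expSet_card_mul D (k + e) hD)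
  let T : (Fin M → restrictTotalDegree σ ℝ k) →ₗ[ℝ] MvPolynomial σ ℝ :=
    ∑ i : Fin M, (LinearMap.mulRight ℝ (g ^ (i : ℕ))) ∘ₗ (aeval Ψ).toLinearMap ∘ₗ
      (restrictTotalDegree σ ℝ k).subtype ∘ₗ LinearMap.proj i
  have hT : ∀ a, T a = ∑ i : Fin M, aeval Ψ (a i : MvPolynomial σ ℝ) * g ^ (i : ℕ) := by
    intro a; simp [T]
  have hmem : ∀ a, T a ∈ restrictTotalDegree σ ℝ (D * (k + e)) := by
    intro a
    rw [mem_restrictTotalDegree, hT]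
    refine totalDegree_finsetSum_le fun i _ => (totalDegree_mul _ _).trans ?_
    have h1 := (aux_totalDegree_aeval D Ψ hΨ (a i)).trans
      (Nat.mul_le_mul_left _ ((mem_restrictTotalDegree _ _ _).1 (a i).2))
    have h2 := (totalDegree_pow g i).trans (Nat.mul_le_mul_right _ i.2.le)
    have h3 : e ≤ D * e := Nat.le_mul_of_pos_left _ hD
    rw [mul_add]
    exact add_le_add h1 (h2.trans h3)
  let T' := T.codRestrict _ hmem
  have hinj : Function.Injective T' := by
    rw [injective_iff_map_eq_zero]
    intro a ha
    have ha0 : T a = 0 := congrArg Subtype.val ha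
    rw [hT] at ha0
    funext i0
    apply Subtype.ext
    refine funext_set (fun _ => Set.Ioo (-δ) δ) (fun _ => Set.Ioo_infinite (by linarith)) ?_
    intro b hb
    obtain ⟨x, hx, hxi⟩ := H b (fun i => abs_lt.2 (by simpa using hb i trivial))
    have hz := Matrix.eq_zero_of_forall_index_sum_pow_mul_eq_zero (f := fun j => eval (x j) g)
      (v := fun i => eval b (a i : MvPolynomial σ ℝ)) hxi (by
        intro j
        have := congrArg (eval (x j)) ha0
        rw [map_sum, map_zero] at this
        rw [← this]
        refine Finset.sum_congr rfl fun i _ => ?_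
        rw [map_mul, map_pow, mul_comm]
        congr 1
        have hb' : b = fun i => eval (x j) (Ψ i) := funext fun i => (hx j i).symm
        rw [hb', ← MvPolynomial.coe_aeval_eq_eval, ← MvPolynomial.coe_aeval_eq_eval]
        have := MvPolynomial.comp_aeval_apply (f := Ψ) (aeval (x j) : MvPolynomial σ ℝ →ₐ[ℝ] ℝ) (a i : MvPolynomial σ ℝ)
        exact this.symm)
    simpa using congrFun hz i0
  have hle := LinearMap.finrank_le_finrank_of_injective hinj
  rw [Module.finrank_pi_fintype] at hle
  simpa [finrank_restrict] using hle

lemma hasDeriv_update {σ : Type} [DecidableEq σ] [Fintype σ] (x : σ → ℝ) (i : σ) (p : MvPolynomial σ ℝ) (s : ℝ) :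
    HasDerivAt (fun s : ℝ => eval (Function.update x i s) p)
      (eval (Function.update x i s) (pderiv i p)) s := by
  induction p using MvPolynomial.induction_on with
  | C a => simpa using hasDerivAt_const s a
  | add p q hp hq =>
    have := hp.add hq
    simp only [map_add]
    exact this
  | mul_X p j hp =>
    have hX : HasDerivAt (fun s : ℝ => eval (Function.update x i s) (X j : MvPolynomial σ ℝ))
        (eval (Function.update x i s) (pderiv i (X j : MvPolynomial σ ℝ))) s := by
      by_cases h : j = i
      · subst h
        simp only [eval_X, Function.update_self, pderiv_X_self, map_one]
        exact hasDerivAt_id s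
      · simpa [Function.update_of_ne h, pderiv_X_of_ne h] using hasDerivAt_const s (x j)
    have := hp.mul hX
    simp only [map_mul, pderiv_mul, map_add]
    exact this

lemma pderiv_localMin {σ : Type} [Fintype σ] (x : σ → ℝ) (i : σ) (p : MvPolynomial σ ℝ)
    (h : IsLocalMin (fun y => eval y p) x) : eval x (pderiv i p) = 0 := by
  classical
  have hd := hasDeriv_update x i p (x i)
  rw [Function.update_eq_self] at hd
  refine IsLocalMin.hasDerivAt_eq_zero ?_ hd
  have hc : Filter.Tendsto (fun s : ℝ => Function.update x i s) (nhds (x i)) (nhds x) := by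
    have : Continuous (fun s : ℝ => Function.update x i s) := continuous_const.update i continuous_id
    simpa using this.tendsto (x i)
  have := hc.eventually h
  simpa [IsLocalMin, IsMinFilter] using this

lemma totalDegree_pderiv_le' {σ : Type*} (i : σ) (p : MvPolynomial σ ℝ) :
    (pderiv i p).totalDegree ≤ p.totalDegree - 1 := by
  classical
  rw [totalDegree, Finset.sup_le_iff]
  intro s hs
  rw [mem_support_iff, coeff_pderiv] at hs
  have h1 : s + Finsupp.single i 1 ∈ p.support := by
    rw [mem_support_iff]
    intro h0
    simp [h0] at hs
  have := le_totalDegree h1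
  rw [Finsupp.sum_add_index' (by simp) (by simp)] at this
  simp at this
  omega

lemma components_bound {σ : Type} [Fintype σ] (D M : ℕ) (hD : 0 < D) (G g : MvPolynomial σ ℝ)
    (hG : G.totalDegree ≤ D + 1) (hpos : ∀ x, 0 ≤ eval x G)
    (hfin : {v : ℝ | ∃ x, eval x G = 0 ∧ eval x g = v}.Finite)
    (p : Fin M → σ → ℝ) (hp : ∀ j, eval (p j) G = 0)
    (hinj : Function.Injective fun j => eval (p j) g) : M ≤ D ^ Fintype.card σ := by
  classical
  set v : Fin M → ℝ := fun j => eval (p j) g with hv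
  -- separation
  obtain ⟨η, hη, hsep⟩ : ∃ η : ℝ, 0 < η ∧ ∀ a ∈ {v : ℝ | ∃ x, eval x G = 0 ∧ eval x g = v},
      ∀ b ∈ {v : ℝ | ∃ x, eval x G = 0 ∧ eval x g = v}, a ≠ b → 2 * η < |a - b| := by
    set F := {v : ℝ | ∃ x, eval x G = 0 ∧ eval x g = v}
    have hF2 : ((F ×ˢ F) ∩ {ab | ab.1 ≠ ab.2}).Finite := (hfin.prod hfin).inter_of_left _
    rcases ((F ×ˢ F) ∩ {ab | ab.1 ≠ ab.2}).eq_empty_or_nonempty with h | h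
    · refine ⟨1, one_pos, fun a ha b hb hab => ?_⟩
      have : (a, b) ∈ ((F ×ˢ F) ∩ {ab | ab.1 ≠ ab.2}) := ⟨⟨ha, hb⟩, hab⟩
      rw [h] at this
      exact this.elim
    · obtain ⟨ab, hab, hmin⟩ := Set.exists_min_image _ (fun ab : ℝ × ℝ => |ab.1 - ab.2|) hF2 h
      have h1 : 0 < |ab.1 - ab.2| := abs_pos.2 (sub_ne_zero.2 hab.2)
      refine ⟨|ab.1 - ab.2| / 3, by positivity, fun a ha b hb hne => ?_⟩
      have := hmin (a, b) ⟨⟨ha, hb⟩, hne⟩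
      simp only at this
      linarith
  have hvF : ∀ j, v j ∈ {v : ℝ | ∃ x, eval x G = 0 ∧ eval x g = v} := fun j => ⟨p j, hp j, rfl⟩
  let N : (σ → ℝ) → ℝ := fun x => ∑ i, x i ^ 2
  have hN0 : ∀ x, 0 ≤ N x := fun x => Finset.sum_nonneg fun i _ => sq_nonneg _
  have hNc : Continuous N := by fun_prop
  have hGc : Continuous fun x : σ → ℝ => eval x G := MvPolynomial.continuous_eval G
  have hgc : Continuous fun x : σ → ℝ => eval x g := MvPolynomial.continuous_eval g
  set R : ℝ := (∑ j, N (p j)) + 5 with hR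
  have hpR : ∀ j, N (p j) + 5 ≤ R := fun j => by
    have := Finset.single_le_sum (f := fun j => N (p j)) (fun j _ => hN0 _) (Finset.mem_univ j)
    linarith
  have hR0 : 0 ≤ R := by
    have := Finset.sum_nonneg (s := Finset.univ) (f := fun j => N (p j)) (fun j _ => hN0 _)
    linarith
  have hball : IsCompact {x : σ → ℝ | N x ≤ R} := by
    refine Metric.isCompact_of_isClosed_isBounded (isClosed_le hNc continuous_const) ?_
    refine (Metric.isBounded_closedBall (x := (0 : σ → ℝ)) (r := R + 1)).subset ?_
    intro x hx
    rw [mem_closedBall_zero_iff, pi_norm_le_iff_of_nonneg (by linarith)]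
    intro i
    have h1 := Finset.single_le_sum (f := fun i => x i ^ 2) (fun i _ => sq_nonneg _) (Finset.mem_univ i)
    have h2 : N x ≤ R := hx
    rw [Real.norm_eq_abs]
    have h3 : |x i| ^ 2 = x i ^ 2 := sq_abs _
    have h4 : x i ^ 2 ≤ R := h1.trans h2
    nlinarith [abs_nonneg (x i), sq_nonneg (|x i| - 1)]
  -- lower bound on G on the boundary
  obtain ⟨δ, hδ, hδG⟩ : ∃ δ : ℝ, 0 < δ ∧ ∀ x, N x ≤ R → (∃ j, |eval x g - v j| = η) → δ ≤ eval x G := by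
    have hBc : IsCompact ({x : σ → ℝ | N x ≤ R} ∩ ⋃ j, {x | |eval x g - v j| = η}) := by
      refine hball.inter_right (isClosed_iUnion_of_finite fun j => ?_)
      exact isClosed_eq ((hgc.sub continuous_const).abs) continuous_const
    rcases ({x : σ → ℝ | N x ≤ R} ∩ ⋃ j, {x | |eval x g - v j| = η}).eq_empty_or_nonempty with h | h
    · refine ⟨1, one_pos, fun x hx ⟨j, hj⟩ => ?_⟩
      have : x ∈ ({x : σ → ℝ | N x ≤ R} ∩ ⋃ j, {x | |eval x g - v j| = η}) :=
        ⟨hx, Set.mem_iUnion.2 ⟨j, hj⟩⟩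
      rw [h] at this
      exact this.elim
    · obtain ⟨z, hz, hmin⟩ := hBc.exists_isMinOn h hGc.continuousOn
      refine ⟨eval z G, ?_, fun x hx ⟨j, hj⟩ => hmin ⟨hx, Set.mem_iUnion.2 ⟨j, hj⟩⟩⟩
      rcases (hpos z).lt_or_eq with h0 | h0
      · exact h0
      · exfalso
        obtain ⟨j, hj⟩ := Set.mem_iUnion.1 hz.2
        have hj : |eval z g - v j| = η := hj
        have hne : eval z g ≠ v j := by
          intro he
          rw [he, sub_self, abs_zero] at hj
          linarith
        have := hsep _ ⟨z, h0.symm, rfl⟩ _ (hvF j) hne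
        linarith
  set ε : ℝ := δ / (R + 10) with hε
  have hε0 : 0 < ε := by positivity
  have hεR : ε * (R + 10) = δ := by rw [hε]; field_simp
  set ρ : ℝ := 1 / (R + Fintype.card σ + 1) with hρ
  have hρ0 : 0 < ρ := by positivity
  have hax : ∀ a : σ → ℝ, (∀ i, |a i| < ρ) → ∀ x, N x ≤ R → |∑ i, a i * x i| ≤ 1 := by
    intro a ha x hx
    calc |∑ i, a i * x i| ≤ ∑ i, |a i * x i| := Finset.abs_sum_le_sum_abs _ _
      _ ≤ ∑ i, ρ * (x i ^ 2 + 1) := by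
        refine Finset.sum_le_sum fun i _ => ?_
        rw [abs_mul]
        refine mul_le_mul (ha i).le ?_ (abs_nonneg _) hρ0.le
        nlinarith [sq_abs (x i), sq_nonneg (|x i| - 1), abs_nonneg (x i)]
      _ = ρ * (N x + Fintype.card σ) := by
        rw [← Finset.mul_sum, Finset.sum_add_distrib]; simp [N]
      _ ≤ ρ * (R + Fintype.card σ + 1) := by
        refine mul_le_mul_of_nonneg_left ?_ hρ0.le; linarith
      _ = 1 := by rw [hρ]; field_simp
  refine bezout_bound D M hD (fun i => C (1 / (2 * ε)) * pderiv i G + X i) ?_ g ρ hρ0 ?_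
  · intro i
    refine (totalDegree_add _ _).trans (max_le ?_ (by rw [totalDegree_X]; omega))
    refine (totalDegree_mul _ _).trans ?_
    rw [totalDegree_C, zero_add]
    have := totalDegree_pderiv_le' i G
    omega
  intro a ha
  let P : MvPolynomial σ ℝ := G + C ε * (∑ i, X i ^ 2 - C 2 * ∑ i, C (a i) * X i)
  have hPe : ∀ x, eval x P = eval x G + ε * (N x - 2 * ∑ i, a i * x i) := by
    intro x; simp [P, N]
  have hPd : ∀ x i, eval x (pderiv i P) = eval x (pderiv i G) + ε * (2 * x i - 2 * a i) := by
    intro x i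
    have e1 : ∀ j, eval x (pderiv i (X j ^ 2 : MvPolynomial σ ℝ)) = if j = i then 2 * x i else 0 := by
      intro j
      by_cases h : j = i
      · subst h; simp
      · simp [pderiv_X_of_ne h, h]
    have e2 : ∀ j, eval x (pderiv i (X j : MvPolynomial σ ℝ)) = if j = i then 1 else 0 := by
      intro j
      by_cases h : j = i
      · subst h; simp
      · simp [pderiv_X_of_ne h, h]
    simp only [P, map_add, map_sub, pderiv_C_mul, map_mul, map_sum, e1, e2, eval_C]
    simp
  have hex : ∀ j, ∃ x : σ → ℝ, (∀ i, eval x (pderiv i P) = 0) ∧ |eval x g - v j| < η := by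
    intro j
    have hK : IsCompact ({x : σ → ℝ | N x ≤ R} ∩ {x | |eval x g - v j| ≤ η}) :=
      hball.inter_right (isClosed_le ((hgc.sub continuous_const).abs) continuous_const)
    have hpK : p j ∈ ({x : σ → ℝ | N x ≤ R} ∩ {x | |eval x g - v j| ≤ η}) := by
      refine ⟨?_, ?_⟩
      · have := hpR j
        show N (p j) ≤ R
        linarith
      · show |eval (p j) g - v j| ≤ η
        simp [hv, hη.le]
    obtain ⟨z, hz, hmin⟩ := hK.exists_isMinOn ⟨_, hpK⟩ (MvPolynomial.continuous_eval P).continuousOn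
    have hzp : eval z P ≤ eval (p j) P := hmin hpK
    have hz1 : N z ≤ R := hz.1
    have hz2 : |eval z g - v j| ≤ η := hz.2
    rw [hPe, hPe, hp j] at hzp
    have hb1 := abs_le.1 (hax a ha z hz1)
    have hb2 := abs_le.1 (hax a ha (p j) hpK.1)
    have hNp := hpR j
    have hNz := hN0 z
    have hGz := hpos z
    have hlt2 : |eval z g - v j| < η := by
      refine lt_of_le_of_ne hz2 fun he => ?_
      have := hδG z hz1 ⟨j, he⟩
      nlinarith
    have hlt1 : N z < R := by
      refine lt_of_le_of_ne hz1 fun he => ?_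
      rw [he] at hzp
      nlinarith
    refine ⟨z, fun i => pderiv_localMin z i P ?_, hlt2⟩
    have hopen : IsOpen ({x : σ → ℝ | N x < R} ∩ {x | |eval x g - v j| < η}) :=
      (isOpen_lt hNc continuous_const).inter (isOpen_lt ((hgc.sub continuous_const).abs) continuous_const)
    filter_upwards [hopen.mem_nhds ⟨hlt1, hlt2⟩] with y hy
    have hy1 : N y < R := hy.1
    have hy2 : |eval y g - v j| < η := hy.2
    exact hmin ⟨hy1.le, hy2.le⟩
  choose x hx1 hx2 using hex
  refine ⟨x, fun j i => ?_, fun j k hjk => ?_⟩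
  · have := hx1 j i
    rw [hPd] at this
    simp only [map_add, map_mul, eval_C, eval_X]
    field_simp
    linarith
  · by_contra hne
    have h1 := hsep _ (hvF j) _ (hvF k) (fun h => hne (hinj h))
    have h2 := abs_lt.1 (hx2 j)
    have h3 := abs_lt.1 (hx2 k)
    simp only at hjk
    rw [hjk] at h2
    have : |v j - v k| < 2 * η := abs_lt.2 ⟨by linarith, by linarith⟩
    linarith

/-- The KKT polynomials. -/
noncomputable def kktPoly {t l : ℕ} (h₀ : MvPolynomial (Fin t) ℝ) (h : Fin l → MvPolynomial (Fin t) ℝ) :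
    Fin l ⊕ Fin t → MvPolynomial (Fin t ⊕ Fin l) ℝ
  | .inl j => rename Sum.inl (h j)
  | .inr i => rename Sum.inl (pderiv i h₀) -
      ∑ j, X (Sum.inr j) * rename Sum.inl (pderiv i (h j))

lemma kktPoly_mem {t l : ℕ} (h₀ : MvPolynomial (Fin t) ℝ) (h : Fin l → MvPolynomial (Fin t) ℝ)
    (z : Fin t ⊕ Fin l → ℝ) :
    (∀ k, eval z (kktPoly h₀ h k) = 0) ↔ (z ∘ Sum.inl, z ∘ Sum.inr) ∈ KKTset h₀ h := by
  simp [KKTset, kktPoly, Sum.forall, eval_rename, sub_eq_zero]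

lemma kktPoly_deg {t l : ℕ} (d : ℕ) (hd : 2 ≤ d) (h₀ : MvPolynomial (Fin t) ℝ)
    (h : Fin l → MvPolynomial (Fin t) ℝ) (hdeg₀ : h₀.totalDegree ≤ d)
    (hdeg : ∀ j, (h j).totalDegree ≤ d) (k) : (kktPoly h₀ h k).totalDegree ≤ d := by
  rcases k with j | i
  · exact (totalDegree_rename_le _ _).trans (hdeg j)
  · refine (totalDegree_sub _ _).trans (max_le ?_ ?_)
    · refine (totalDegree_rename_le _ _).trans ((totalDegree_pderiv_le' _ _).trans (by omega))
    · refine totalDegree_finsetSum_le fun j _ => (totalDegree_mul _ _).trans ?_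
      have h1 := (totalDegree_rename_le (Sum.inl : Fin t → Fin t ⊕ Fin l) (pderiv i (h j))).trans
        (totalDegree_pderiv_le' _ _)
      have h2 := hdeg j
      rw [totalDegree_X]
      omega

lemma kkt_finite {t l : ℕ} (h₀ : MvPolynomial (Fin t) ℝ) (h : Fin l → MvPolynomial (Fin t) ℝ) :
    {v : ℝ | ∃ z : Fin t ⊕ Fin l → ℝ, (∀ k, eval z (kktPoly h₀ h k) = 0) ∧
      eval z (rename Sum.inl h₀) = v}.Finite := by
  refine (aux_finite (Ideal.span (Set.range (kktPoly h₀ h))) (rename Sum.inl h₀)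
    (fun j : Fin l => rename Sum.inl (h j)) (fun j => X (Sum.inr j)) ?_ ?_).subset ?_
  · exact fun j => Ideal.subset_span ⟨.inl j, rfl⟩
  · have hz : ∀ (j : Fin l) (p : MvPolynomial (Fin t) ℝ),
        pderiv (Sum.inr j : Fin t ⊕ Fin l) (rename Sum.inl p) = 0 := by
      classical
      intro j p
      refine pderiv_eq_zero_of_notMem_vars fun hm => ?_
      have := vars_rename _ _ hm
      simp at this
    rintro (i | j)
    · refine Ideal.subset_span ⟨.inr i, ?_⟩
      simp [kktPoly, pderiv_rename Sum.inl_injective]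
    · simp [hz]
  · rintro v ⟨z, hz, rfl⟩
    refine ⟨z, fun p hp => ?_, rfl⟩
    have : Ideal.span (Set.range (kktPoly h₀ h)) ≤ RingHom.ker (eval z) := by
      rw [Ideal.span_le]
      rintro _ ⟨k, rfl⟩
      exact hz k
    exact this hp

lemma kkt_card {t l : ℕ} (d : ℕ) (hd : 2 ≤ d) (h₀ : MvPolynomial (Fin t) ℝ)
    (h : Fin l → MvPolynomial (Fin t) ℝ) (hdeg₀ : h₀.totalDegree ≤ d)
    (hdeg : ∀ j, (h j).totalDegree ≤ d) :
    (kkt_finite h₀ h).toFinset.card ≤ (2 * d - 1) ^ (t + l) := by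
  classical
  set s := (kkt_finite h₀ h).toFinset with hs
  let G : MvPolynomial (Fin t ⊕ Fin l) ℝ := ∑ k, kktPoly h₀ h k ^ 2
  have hGe : ∀ z, eval z G = ∑ k, eval z (kktPoly h₀ h k) ^ 2 := fun z => by simp only [G, map_sum, map_pow]
  have hG0 : ∀ z, eval z G = 0 ↔ ∀ k, eval z (kktPoly h₀ h k) = 0 := by
    intro z
    rw [hGe, Finset.sum_eq_zero_iff_of_nonneg (fun _ _ => sq_nonneg _)]
    simp
  have hmem : ∀ v : s, ∃ z : Fin t ⊕ Fin l → ℝ, (∀ k, eval z (kktPoly h₀ h k) = 0) ∧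
      eval z (rename Sum.inl h₀) = v := fun v => by
    exact (kkt_finite h₀ h).mem_toFinset.1 v.2
  choose z hz1 hz2 using hmem
  have := components_bound (2 * d - 1) s.card (by omega) G (rename Sum.inl h₀) ?_ ?_ ?_
    (fun j => z (s.equivFin.symm j)) ?_ ?_
  · simpa using this
  · refine totalDegree_finsetSum_le fun k _ => (totalDegree_pow _ _).trans ?_
    have := kktPoly_deg d hd h₀ h hdeg₀ hdeg k
    omega
  · intro x
    rw [hGe]
    exact Finset.sum_nonneg fun _ _ => sq_nonneg _
  · simp only [hG0]
    exact kkt_finite h₀ h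
  · intro j
    rw [hG0]
    exact hz1 _
  · intro i j hij
    simp only [hz2] at hij
    exact s.equivFin.symm.injective (Subtype.ext hij)

/-- **Theorem 3.1 (Nichtnegativstellensatz on singular varieties under
denseness of the regular locus).** Let `V ⊆ ℝⁿ`, `f ∈ ℝ[x]`, `W = V(h) ⊆ ℝᵗ`,
and let `φ` be a polynomial map with `φ(W) ⊆ V`. Assume a set `S ⊆ V` dense in
`V` satisfies `S ⊆ φ(W)` (e.g. `S = V^reg` under a resolution of
singularities). Let `h₀ = f ∘ φ`, let `d ≥ 2` bound the degrees of
`h₀, h₁,…,h_l`, assume `h₀` attains its infimum on `W` at a global minimizer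
`y*` at which the KKT conditions hold. With
`u = max{d(c(t+l,d,t+l)-1), b(t+l,d,l+t+1)/2 + d}`, the following are
equivalent: (a) `f ≥ 0` on `V`; (b) there is `σ ∈ Σ²_u[y,λ]` such that
`h₀ - σ` vanishes on `V(h̄_KKT)`. -/
theorem stmt_18 {n t l : ℕ} (d : ℕ) (hd : 2 ≤ d)
    (V : Set (Fin n → ℝ)) (f : MvPolynomial (Fin n) ℝ)
    (h : Fin l → MvPolynomial (Fin t) ℝ)
    (W : Set (Fin t → ℝ)) (hW : W = {y | ∀ j, eval y (h j) = 0})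
    (Φ : Fin n → MvPolynomial (Fin t) ℝ)
    (φ : (Fin t → ℝ) → (Fin n → ℝ)) (hφ : ∀ y, φ y = fun i => eval y (Φ i))
    (hφW : φ '' W ⊆ V)
    (S : Set (Fin n → ℝ)) (hSV : S ⊆ V) (hdense : V ⊆ closure S)
    (hSφ : S ⊆ φ '' W)
    (h₀ : MvPolynomial (Fin t) ℝ) (hh₀ : h₀ = aeval Φ f)
    (hdeg₀ : h₀.totalDegree ≤ d) (hdeg : ∀ j, (h j).totalDegree ≤ d)
    (ystar : Fin t → ℝ) (hyW : ystar ∈ W)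
    (hymin : ∀ y ∈ W, eval ystar h₀ ≤ eval y h₀)
    (lamstar : Fin l → ℝ) (hKKT : (ystar, lamstar) ∈ KKTset h₀ h)
    (u : ℕ)
    (hu : u = max (d * (cFun (t + l) d (t + l) - 1))
              (bFun (t + l) d (l + t + 1) / 2 + d)) :
    (∀ x ∈ V, 0 ≤ eval x f) ↔
      ∃ σ : MvPolynomial (Fin t ⊕ Fin l) ℝ, IsSOS u σ ∧
        ∀ p ∈ KKTset h₀ h, eval p.1 h₀ = eval (Sum.elim p.1 p.2) σ := by
  have hval : ∀ y, eval y h₀ = eval (φ y) f := by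
    intro y
    rw [hh₀, hφ, ← MvPolynomial.coe_aeval_eq_eval, ← MvPolynomial.coe_aeval_eq_eval]
    exact MvPolynomial.comp_aeval_apply (f := Φ) (aeval y : MvPolynomial (Fin t) ℝ →ₐ[ℝ] ℝ) f
  constructor
  · intro hf
    have hnn : ∀ y ∈ W, 0 ≤ eval y h₀ := fun y hy => by
      rw [hval]; exact hf _ (hφW ⟨y, hy, rfl⟩)
    set s := (kkt_finite h₀ h).toFinset with hs
    have hcard := kkt_card d hd h₀ h hdeg₀ hdeg
    rw [← hs] at hcard
    have hKs : ∀ p ∈ KKTset h₀ h, eval p.1 h₀ ∈ s := by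
      intro p hp
      rw [hs, Set.Finite.mem_toFinset]
      refine ⟨Sum.elim p.1 p.2, (kktPoly_mem h₀ h _).2 (by simpa using hp), ?_⟩
      simp [eval_rename]
    let q := Lagrange.interpolate s id (fun v => Real.sqrt v)
    have hqdeg : q.natDegree ≤ s.card - 1 := by
      have := Lagrange.degree_interpolate_lt (s := s) (v := id) (fun v => Real.sqrt v)
        Function.injective_id.injOn
      by_cases hq : q = 0
      · simp [hq]
      · have := (Polynomial.natDegree_lt_iff_degree_lt hq).2 this
        omega
    refine ⟨(Polynomial.aeval (rename Sum.inl h₀) q) ^ 2, ⟨1, fun _ => Polynomial.aeval (rename Sum.inl h₀) q, ?_, by simp⟩, ?_⟩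
    · intro _
      refine (aux_totalDegree_poly d _ ((totalDegree_rename_le _ _).trans hdeg₀) q).trans ?_
      rw [hu]
      refine le_max_of_le_left (Nat.mul_le_mul_left _ (hqdeg.trans (Nat.sub_le_sub_right ?_ 1)))
      refine hcard.trans ?_
      unfold cFun
      rcases Nat.eq_zero_or_pos (t + l) with h0 | h0
      · rw [h0]; simp; omega
      · calc (2 * d - 1) ^ (t + l) ≤ (2 * d - 1) ^ (t + l + (t + l) - 1) :=
              Nat.pow_le_pow_right (by omega) (by omega)
          _ ≤ _ := Nat.le_mul_of_pos_left _ (by omega)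
    · intro p hp
      have hpW : p.1 ∈ W := by rw [hW]; exact hp.1
      have h3 := Polynomial.aeval_algHom_apply
        (aeval (Sum.elim p.1 p.2) : MvPolynomial (Fin t ⊕ Fin l) ℝ →ₐ[ℝ] ℝ) (rename Sum.inl h₀) q
      have h4 : eval (Sum.elim p.1 p.2) (rename Sum.inl h₀) = eval p.1 h₀ := by simp [eval_rename]
      have h5 : eval (Sum.elim p.1 p.2) (Polynomial.aeval (rename Sum.inl h₀) q) =
          Polynomial.eval (eval p.1 h₀) q := by
        rw [← h4]
        simpa [MvPolynomial.aeval_eq_eval] using h3.symm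
      have h6 : Polynomial.eval (eval p.1 h₀) q = Real.sqrt (eval p.1 h₀) :=
        Lagrange.eval_interpolate_at_node (s := s) (v := id) (fun v => Real.sqrt v)
          Function.injective_id.injOn (hKs p hp)
      rw [map_pow, h5, h6, Real.sq_sqrt (hnn _ hpW)]
  · rintro ⟨σ, ⟨k, q, _, rfl⟩, hσ⟩
    have hst : 0 ≤ eval ystar h₀ := by
      rw [hσ _ hKKT, map_sum]
      exact Finset.sum_nonneg fun i _ => by rw [map_pow]; exact sq_nonneg _
    have hcl : IsClosed {x : Fin n → ℝ | 0 ≤ eval x f} :=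
      isClosed_le continuous_const (MvPolynomial.continuous_eval f)
    intro x hx
    refine closure_minimal ?_ hcl (hdense hx)
    intro y hy
    obtain ⟨w, hw, rfl⟩ := hSφ hy
    show 0 ≤ eval (φ w) f
    rw [← hval]
    exact hst.trans (hymin w hw)
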